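/- arXiv:2105.00341 — 2 statements merged into one kernel-verified Lean document; each statement's English description precedes it below -/
import Mathlib

section
/- If C is a symmetric positive-definite 3×3 real matrix whose three eigenvalues are pairwise distinct, then the set {Q : QᵀQ = 1, det Q = 1, Q·C = C·Q} of special orthogonal matrices commuting with C has exactly 4 elements (the identity and the three rotations through angle π about the three eigendirections of C). -/
open Matrix

/-- A matrix commuting with a diagonal matrix with distinct diagonal entries is diagonal. -/
theorem eq_diagonal_of_commute_diagonal {n R : Type*} [Fintype n] [DecidableEq n] [CommRing R]
    [IsDomain R] {d : n → R} (hd : Function.Injective d) {P : Matrix n n R}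
    (h : P * diagonal d = diagonal d * P) : P = diagonal P.diag := by
  ext i j
  by_cases hij : i = j
  · simp [hij]
  · have hentry := congrFun (congrFun h i) j
    rw [mul_diagonal, diagonal_mul] at hentry
    have hprod : P i j * (d j - d i) = 0 := by linear_combination hentry
    rw [diagonal_apply_ne _ hij]
    exact (mul_eq_zero.mp hprod).resolve_right (sub_ne_zero.mpr (hd.ne (Ne.symm hij)))

/-- The special orthogonal 3×3 matrices commuting with a diagonal matrix with distinct diagonal
entries are the diagonal sign matrices of determinant one. -/
theorem setOf_commute_diagonal_SO3 {d : Fin 3 → ℝ} (hd : Function.Injective d) :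
    {P : Matrix (Fin 3) (Fin 3) ℝ |
      Pᵀ * P = 1 ∧ P.det = 1 ∧ P * diagonal d = diagonal d * P} =
    diagonal '' {![1, 1, 1], ![1, -1, -1], ![-1, 1, -1], ![-1, -1, 1]} := by
  ext P
  constructor
  · rintro ⟨horth, hdet, hcomm⟩
    have hP := eq_diagonal_of_commute_diagonal hd hcomm
    refine ⟨P.diag, ?_, hP.symm⟩
    rw [hP, diagonal_transpose, diagonal_mul_diagonal] at horth
    rw [hP, det_diagonal, Fin.prod_univ_three] at hdet
    have hsign (i : Fin 3) : P.diag i = 1 ∨ P.diag i = -1 := by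
      have hentry := congrFun (congrFun horth i) i
      rw [diagonal_apply_eq, one_apply_eq] at hentry
      exact mul_self_eq_one_iff.mp hentry
    have hvec : P.diag = ![P.diag 0, P.diag 1, P.diag 2] := by
      ext i
      fin_cases i <;> rfl
    rw [hvec]
    rcases hsign 0 with h0 | h0 <;> rcases hsign 1 with h1 | h1 <;>
      rcases hsign 2 with h2 | h2 <;> rw [h0, h1, h2] at hdet ⊢ <;> norm_num at hdet <;> simp
  · rintro ⟨s, hs, rfl⟩
    refine ⟨?_, ?_, ?_⟩
    · rw [diagonal_transpose, diagonal_mul_diagonal, ← diagonal_one, diagonal_eq_diagonal_iff]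
      rcases hs with rfl | rfl | rfl | rfl <;> simp [Fin.forall_fin_succ]
    · rw [det_diagonal, Fin.prod_univ_three]
      rcases hs with rfl | rfl | rfl | rfl <;> simp
    · simp only [diagonal_mul_diagonal, mul_comm]

theorem ncard_sign_vectors_prod_one :
    ({![1, 1, 1], ![1, -1, -1], ![-1, 1, -1], ![-1, -1, 1]} : Set (Fin 3 → ℝ)).ncard = 4 := by
  have hne : (1 : ℝ) ≠ -1 := by norm_num
  rw [Set.ncard_insert_of_notMem, Set.ncard_insert_of_notMem, Set.ncard_pair] <;>
    simp [hne, hne.symm]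

/-- Conjugation by an orthogonal matrix carries the special orthogonal matrices commuting with
`Uᵀ * C * U` onto those commuting with `C`. -/
theorem setOf_commute_SO_eq_image {n R : Type*} [Fintype n] [DecidableEq n] [CommRing R]
    {U : Matrix n n R} (hU : Uᵀ * U = 1) (C : Matrix n n R) :
    {Q : Matrix n n R | Qᵀ * Q = 1 ∧ Q.det = 1 ∧ Q * C = C * Q} =
    (fun P => U * P * Uᵀ) ''
      {P | Pᵀ * P = 1 ∧ P.det = 1 ∧ P * (Uᵀ * C * U) = Uᵀ * C * U * P} := by
  have hU' : U * Uᵀ = 1 := mul_eq_one_comm.mp hU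
  have cancel (X : Matrix n n R) : Uᵀ * (U * X) = X := by rw [← mul_assoc, hU, one_mul]
  have cancel' (X : Matrix n n R) : U * (Uᵀ * X) = X := by rw [← mul_assoc, hU', one_mul]
  have hdetU : U.det * U.det = 1 := by simpa using congrArg det hU
  ext Q
  constructor
  · rintro ⟨horth, hdet, hcomm⟩
    have orth (X : Matrix n n R) : Qᵀ * (Q * X) = X := by rw [← mul_assoc, horth, one_mul]
    have comm (X : Matrix n n R) : Q * (C * X) = C * (Q * X) := by
      rw [← mul_assoc, hcomm, mul_assoc]
    refine ⟨Uᵀ * Q * U, ⟨?_, ?_, ?_⟩, ?_⟩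
    · simp only [transpose_mul, transpose_transpose, mul_assoc, cancel', orth, hU]
    · rw [det_mul, det_mul, det_transpose, hdet, mul_one, hdetU]
    · simp only [mul_assoc, cancel', comm]
    · simp only [mul_assoc, cancel', hU', mul_one]
  · rintro ⟨P, ⟨horth, hdet, hcomm⟩, rfl⟩
    have orth (X : Matrix n n R) : Pᵀ * (P * X) = X := by rw [← mul_assoc, horth, one_mul]
    refine ⟨?_, ?_, ?_⟩
    · simp only [transpose_mul, transpose_transpose, mul_assoc, cancel, orth, hU']
    · rw [det_mul, det_mul, det_transpose, hdet, mul_one, hdetU]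
    · have h := congrArg (fun X => U * X * Uᵀ) hcomm
      simpa only [mul_assoc, cancel', hU', mul_one] using h

theorem conjugate_transpose_injective {n R : Type*} [Fintype n] [DecidableEq n] [CommRing R]
    {U : Matrix n n R} (hU : Uᵀ * U = 1) : Function.Injective fun P => U * P * Uᵀ := by
  refine Function.LeftInverse.injective (g := fun Q => Uᵀ * Q * U) fun P => ?_
  simp only [mul_assoc, hU, mul_one]
  rw [← mul_assoc, hU, one_mul]

/-- If `C` is a symmetric positive-definite 3×3 real matrix with pairwise distinct
eigenvalues, then the set of special orthogonal matrices commuting with `C` has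
exactly 4 elements (the identity and the three rotations through `π` about the
eigendirections of `C`). -/
theorem commuting_SO3_card_four
    (C : Matrix (Fin 3) (Fin 3) ℝ) (hC : Cᵀ = C)
    (hpos : ∀ x : Fin 3 → ℝ, x ≠ 0 → 0 < x ⬝ᵥ C.mulVec x)
    (lam₁ lam₂ lam₃ : ℝ) (h12 : lam₁ ≠ lam₂) (h13 : lam₁ ≠ lam₃) (h23 : lam₂ ≠ lam₃)
    (U : Matrix (Fin 3) (Fin 3) ℝ) (hU : Uᵀ * U = 1)
    (hdiag : Uᵀ * C * U = Matrix.diagonal ![lam₁, lam₂, lam₃]) :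
    {Q : Matrix (Fin 3) (Fin 3) ℝ | Qᵀ * Q = 1 ∧ Q.det = 1 ∧ Q * C = C * Q}.ncard = 4 := by
  have hinj : Function.Injective ![lam₁, lam₂, lam₃] := by
    intro i j hij
    fin_cases i <;> fin_cases j <;> simp_all
  rw [setOf_commute_SO_eq_image hU,
    Set.ncard_image_of_injective _ (conjugate_transpose_injective hU),
    hdiag, setOf_commute_diagonal_SO3 hinj, Set.ncard_image_of_injective _ diagonal_injective,
    ncard_sign_vectors_prod_one]
end

section
/- If C is a symmetric positive-definite 3×3 real matrix whose three eigenvalues are pairwise distinct, then every special orthogonal matrix commuting with C is an involution: if QᵀQ = 1, det Q = 1, and Q·C = C·Q, then Q·Q = 1. -/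
open Matrix

namespace Matrix

variable {n R : Type*} [Fintype n] [DecidableEq n]

/-- A matrix commuting with a diagonal matrix whose entries are pairwise distinct is diagonal. -/
theorem isDiag_of_commute_diagonal [CommRing R] [IsDomain R] {d : n → R}
    (hd : Function.Injective d) {P : Matrix n n R} (h : Commute P (diagonal d)) : P.IsDiag := by
  intro i j hij
  have hentry : P i j * d j = d i * P i j := by
    simpa only [mul_diagonal, diagonal_mul] using congrFun (congrFun h.eq i) j
  have hzero : (d j - d i) * P i j = 0 := by linear_combination hentry
  exact (mul_eq_zero.mp hzero).resolve_left (sub_ne_zero.mpr (hd.ne hij.symm))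

/-- A matrix commuting with one that is orthogonally diagonalizable with pairwise distinct
eigenvalues is symmetric. -/
theorem isSymm_of_commute_of_transpose_mul_mul_eq_diagonal [CommRing R] [IsDomain R]
    {d : n → R} (hd : Function.Injective d) {C Q U : Matrix n n R} (hU : Uᵀ * U = 1)
    (hdiag : Uᵀ * C * U = diagonal d) (h : Commute Q C) : Q.IsSymm := by
  have hU' : U * Uᵀ = 1 := mul_eq_one_comm.mp hU
  have hconj (A B : Matrix n n R) : Uᵀ * A * U * (Uᵀ * B * U) = Uᵀ * (A * B) * U := by
    calc
      _ = Uᵀ * A * (U * Uᵀ) * B * U := by simp only [Matrix.mul_assoc]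
      _ = _ := by rw [hU', Matrix.mul_one, Matrix.mul_assoc Uᵀ]
  have hcancel (A : Matrix n n R) : U * (Uᵀ * A * U) * Uᵀ = A := by
    calc
      _ = U * Uᵀ * A * (U * Uᵀ) := by simp only [Matrix.mul_assoc]
      _ = A := by rw [hU', Matrix.one_mul, Matrix.mul_one]
  have hP : Commute (Uᵀ * Q * U) (diagonal d) := by
    rw [← hdiag, commute_iff_eq, hconj, hconj, h.eq]
  have hsymm : Uᵀ * Qᵀ * U = Uᵀ * Q * U := by
    simpa [IsSymm, Matrix.mul_assoc] using (isDiag_of_commute_diagonal hd hP).isSymm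
  rw [IsSymm, ← hcancel Qᵀ, hsymm, hcancel]

end Matrix

/-- If `C` is a symmetric positive-definite 3×3 real matrix with pairwise distinct
eigenvalues, then every special orthogonal matrix commuting with `C` is an
involution. -/
theorem commuting_SO3_involution
    (C : Matrix (Fin 3) (Fin 3) ℝ) (hC : Cᵀ = C)
    (hpos : ∀ x : Fin 3 → ℝ, x ≠ 0 → 0 < x ⬝ᵥ C.mulVec x)
    (lam₁ lam₂ lam₃ : ℝ) (h12 : lam₁ ≠ lam₂) (h13 : lam₁ ≠ lam₃) (h23 : lam₂ ≠ lam₃)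
    (U : Matrix (Fin 3) (Fin 3) ℝ) (hU : Uᵀ * U = 1)
    (hdiag : Uᵀ * C * U = Matrix.diagonal ![lam₁, lam₂, lam₃])
    (Q : Matrix (Fin 3) (Fin 3) ℝ) (hQ : Qᵀ * Q = 1) (hdet : Q.det = 1)
    (hcomm : Q * C = C * Q) :
    Q * Q = 1 := by
  have hd : Function.Injective ![lam₁, lam₂, lam₃] := by
    intro i j hij
    fin_cases i <;> fin_cases j <;> simp_all
  have hsymm : Qᵀ = Q :=
    isSymm_of_commute_of_transpose_mul_mul_eq_diagonal hd hU hdiag hcomm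
  rwa [hsymm] at hQ
end
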